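/- arXiv:2110.15379 — 4 statements merged into one kernel-verified Lean document; each statement's English description precedes it below -/
import Mathlib

section
/- The collection {F_I : ∅ ≠ I ⊆ {1,…,n}} of open sets covers M, i.e., M = ⋃_{∅ ≠ I ⊆ {1,…,n}} F_I. (This is part (a) of the paper's Lemma 5.16, used to shrink an atlas of Kuranishi charts on the moduli space of pointlike instantons to a good coordinate system.) -/
/-- Lemma 5.16(a): the sets `F_I = (⋂_{i∈I} G_{i,|I|}) \ (⋃_{i∉I} cl F_{i,|I|})`,
for nonempty `I ⊆ {1,…,n}`, cover the compact Hausdorff space `M`. -/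
theorem shrinking_cover {M : Type*} [TopologicalSpace M] [CompactSpace M] [T2Space M]
    (n : ℕ) (hn : 1 ≤ n)
    (F : Fin n → Set M) (Fk G : Fin n → ℕ → Set M)
    (hFopen : ∀ i, IsOpen (F i))
    (hFkopen : ∀ i k, k ≤ n → IsOpen (Fk i k))
    (hGopen : ∀ i k, 1 ≤ k → k ≤ n → IsOpen (G i k))
    (hFG : ∀ i k, 1 ≤ k → k ≤ n → closure (Fk i (k - 1)) ⊆ G i k)
    (hGF : ∀ i k, 1 ≤ k → k ≤ n → closure (G i k) ⊆ Fk i k)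
    (hFn : ∀ i, closure (Fk i n) ⊆ F i)
    (hcover : (⋃ i, Fk i 0) = Set.univ) :
    (⋃ I ∈ {I : Finset (Fin n) | I.Nonempty},
      ((⋂ i ∈ I, G i I.card) \ (⋃ i ∉ I, closure (Fk i I.card)))) = Set.univ := by
  classical
  refine Set.eq_univ_of_forall fun x => ?_
  let A : ℕ → Finset (Fin n) := fun k => Finset.univ.filter fun i => x ∈ closure (Fk i k)
  have mem_A : ∀ i k, i ∈ A k ↔ x ∈ closure (Fk i k) := fun i k => by simp [A]
  have hA0 : 0 < (A 0).card := by
    obtain ⟨i, hi⟩ := Set.mem_iUnion.1 (hcover.symm ▸ Set.mem_univ x : x ∈ ⋃ i, Fk i 0)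
    exact Finset.card_pos.2 ⟨i, (mem_A i 0).2 (subset_closure hi)⟩
  have hex : ∃ k, (A k).card ≤ k := ⟨n, by simpa using Finset.card_le_univ (A n)⟩
  obtain ⟨k, hk, hmin⟩ : ∃ k, (A k).card ≤ k ∧ ∀ m < k, m < (A m).card :=
    ⟨Nat.find hex, Nat.find_spec hex, fun m hm => not_le.1 (Nat.find_min hex hm)⟩
  have hk1 : 1 ≤ k := by
    rcases Nat.eq_zero_or_pos k with rfl | h
    · omega
    · exact h
  have hprev : k - 1 < (A (k - 1)).card := hmin _ (by omega)
  have hkn : k ≤ n := by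
    have := Finset.card_le_univ (A (k - 1))
    rw [Fintype.card_fin] at this
    omega
  have hG : ∀ i ∈ A (k - 1), x ∈ G i k := fun i hi => hFG i k hk1 hkn ((mem_A i _).1 hi)
  have hsub : A (k - 1) ⊆ A k := fun i hi =>
    (mem_A i k).2 (subset_closure (hGF i k hk1 hkn (subset_closure (hG i hi))))
  have heq : A (k - 1) = A k := Finset.eq_of_subset_of_card_le hsub (by omega)
  have hcard : (A k).card = k := by
    rw [heq] at hprev
    omega
  refine Set.mem_biUnion (x := A k) (Finset.card_pos.1 (by omega)) ?_
  rw [hcard]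
  refine ⟨Set.mem_iInter₂.2 fun i hi => hG i (heq ▸ hi), fun h => ?_⟩
  obtain ⟨i, hi, hxi⟩ := Set.mem_iUnion₂.1 h
  exact hi ((mem_A i k).2 hxi)
end

section
/- The collection {F_I : ∅ ≠ I ⊆ {1,…,n}} satisfies the overlapping condition: for any two nonempty subsets I, J ⊆ {1,…,n}, if closure(F_I) ∩ closure(F_J) ≠ ∅ then I ⊆ J or J ⊆ I. (This is part (b) of the paper's Lemma 5.16.) -/
theorem subset_of_closure_inter_of_card_le {ι M : Type*} [TopologicalSpace M] {n : ℕ}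
    {Fk G : ι → ℕ → Set M}
    (hFkopen : ∀ i k, k ≤ n → IsOpen (Fk i k))
    (hGF : ∀ i k, 1 ≤ k → k ≤ n → closure (G i k) ⊆ Fk i k)
    (hmono : ∀ i k l, k ≤ l → l ≤ n → Fk i k ⊆ Fk i l)
    {I J : Finset ι} (hIJ : I.card ≤ J.card) (hJ : J.card ≤ n) {x : M}
    (hxI : x ∈ closure ((⋂ i ∈ I, G i I.card) \ (⋃ i ∉ I, closure (Fk i I.card))))
    (hxJ : x ∈ closure ((⋂ i ∈ J, G i J.card) \ (⋃ i ∉ J, closure (Fk i J.card)))) :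
    I ⊆ J := by
  intro i hiI
  by_contra hiJ
  have hxG : x ∈ closure (G i I.card) :=
    closure_mono (Set.sdiff_subset.trans (Set.biInter_subset_of_mem hiI)) hxI
  have hxF : x ∈ Fk i J.card :=
    hmono i _ _ hIJ hJ (hGF i _ (Finset.card_pos.2 ⟨i, hiI⟩) (hIJ.trans hJ) hxG)
  obtain ⟨y, hyF, -, hy⟩ := mem_closure_iff.1 hxJ _ (hFkopen i _ hJ) hxF
  exact hy (Set.mem_biUnion (s := {j | j ∉ J}) (t := fun j => closure (Fk j J.card)) hiJ
    (subset_closure hyF))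


/-- Lemma 5.16(b): the sets `F_I = (⋂_{i∈I} G_{i,|I|}) \ (⋃_{i∉I} cl F_{i,|I|})`
satisfy the overlapping condition: if the closures of `F_I` and `F_J` intersect,
then `I ⊆ J` or `J ⊆ I`. -/
theorem shrinking_overlap {M : Type*} [TopologicalSpace M] [CompactSpace M] [T2Space M]
    (n : ℕ) (hn : 1 ≤ n)
    (F : Fin n → Set M) (Fk G : Fin n → ℕ → Set M)
    (hFopen : ∀ i, IsOpen (F i))
    (hFkopen : ∀ i k, k ≤ n → IsOpen (Fk i k))
    (hGopen : ∀ i k, 1 ≤ k → k ≤ n → IsOpen (G i k))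
    (hFG : ∀ i k, 1 ≤ k → k ≤ n → closure (Fk i (k - 1)) ⊆ G i k)
    (hGF : ∀ i k, 1 ≤ k → k ≤ n → closure (G i k) ⊆ Fk i k)
    (hFn : ∀ i, closure (Fk i n) ⊆ F i)
    (hcover : (⋃ i, Fk i 0) = Set.univ) :
    ∀ I J : Finset (Fin n), I.Nonempty → J.Nonempty →
      (closure ((⋂ i ∈ I, G i I.card) \ (⋃ i ∉ I, closure (Fk i I.card))) ∩
        closure ((⋂ i ∈ J, G i J.card) \ (⋃ i ∉ J, closure (Fk i J.card)))).Nonempty →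
      I ⊆ J ∨ J ⊆ I := by
  intro I J _ _ ⟨x, hxI, hxJ⟩
  have hmono : ∀ i k l, k ≤ l → l ≤ n → Fk i k ⊆ Fk i l := by
    intro i k l hkl
    induction l, hkl using Nat.le_induction with
    | base => exact fun _ => subset_rfl
    | succ l _ ih =>
      intro hl
      exact (ih (Nat.le_of_succ_le hl)).trans <| subset_closure.trans <|
        (hFG i (l + 1) l.succ_pos hl).trans <| subset_closure.trans (hGF i (l + 1) l.succ_pos hl)
  have hcard : ∀ K : Finset (Fin n), K.card ≤ n := fun K => by
    simpa using K.card_le_univ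
  rcases le_total I.card J.card with h | h
  · exact Or.inl (subset_of_closure_inter_of_card_le hFkopen hGF hmono h (hcard J) hxI hxJ)
  · exact Or.inr (subset_of_closure_inter_of_card_le hFkopen hGF hmono h (hcard I) hxJ hxI)
end

section
/- Every compact subset Z ⊆ X admits a sequence of shrinking neighborhoods: there exist open subsets W_j ⊆ X (j ∈ ℕ) with Z ⊆ W_j for every j and Z = ⋂_{j∈ℕ} W_j. (This is the paper's Corollary 5.8, proved by induction over the strata; its proof uses only the hypotheses (i) and (ii) below.) -/
/-- A compact set becomes a `Gδ` set after adding the complement of a closed metrizable set. -/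
theorem IsCompact.isGδ_union_compl_of_metrizable {X : Type*} [TopologicalSpace X] {Z C : Set X}
    (hZ : IsCompact Z) (hC : IsClosed C) [TopologicalSpace.MetrizableSpace C] :
    IsGδ (Z ∪ Cᶜ) := by
  have hcomp : IsCompact (Subtype.val ⁻¹' Z : Set C) :=
    hC.isClosedEmbedding_subtypeVal.isCompact_preimage hZ
  let _ := TopologicalSpace.metrizableSpaceMetric C
  obtain ⟨O, hO, hZO⟩ := isGδ_iff_eq_iInter_nat.1 hcomp.isClosed.isGδ
  choose V hV hVO using fun n => isOpen_induced_iff.1 (hO n)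
  have hmem : ∀ x ∈ C, (x ∈ Z ↔ ∀ n, x ∈ V n) := fun x hx => by
    simpa [← hVO] using Set.ext_iff.1 hZO ⟨x, hx⟩
  refine isGδ_iff_eq_iInter_nat.2 ⟨fun n => V n ∪ Cᶜ, fun n => (hV n).union hC.isOpen_compl, ?_⟩
  ext x
  by_cases hx : x ∈ C <;> simp [hx, hmem]

/-- A compact set in a space covered by countably many closed metrizable sets is a `Gδ` set. -/
theorem IsCompact.isGδ_of_iUnion_metrizable {X ι : Type*} [TopologicalSpace X] [Countable ι]
    {Z : Set X} (hZ : IsCompact Z) {C : ι → Set X} (hC : ∀ i, IsClosed (C i))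
    (hmetr : ∀ i, TopologicalSpace.MetrizableSpace (C i)) (hcover : ⋃ i, C i = Set.univ) :
    IsGδ Z := by
  have hZC : Z = ⋂ i, (Z ∪ (C i)ᶜ) := by
    rw [← Set.union_iInter, ← Set.compl_iUnion, hcover, Set.compl_univ, Set.union_empty]
  rw [hZC]
  exact .iInter fun i => hZ.isGδ_union_compl_of_metrizable (hC i)

/-- Removing a relatively open subset from a closed set leaves a closed set. -/
theorem IsClosed.sdiff_of_isOpen_preimage_val {X : Type*} [TopologicalSpace X] {A U : Set X}
    (hA : IsClosed A) (hU : IsOpen (Subtype.val ⁻¹' U : Set A)) : IsClosed (A \ U) := by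
  simpa [← Set.sdiff_eq] using hA.isClosedEmbedding_subtypeVal.isClosedMap _ hU.isClosed_compl


/-- Corollary 5.8: in a space with a finite filtration by closed subsets whose strata
are metrizable and where each filtration level is a countable intersection of relatively
open neighborhoods of the previous level, every compact subset `Z` admits a sequence of
shrinking neighborhoods: open sets `W j ⊇ Z` with `Z = ⋂ j, W j`. -/
theorem compact_shrinking_neighborhoods {X : Type*} [TopologicalSpace X]
    (m : ℕ) (Xf : ℕ → Set X)
    (h0 : Xf 0 = ∅) (hm : Xf m = Set.univ)
    (hclosed : ∀ k, k ≤ m → IsClosed (Xf k))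
    (hmono : ∀ k, k < m → Xf k ⊆ Xf (k + 1))
    (hmetr : ∀ k, 1 ≤ k → k ≤ m →
      TopologicalSpace.MetrizableSpace ↥(Xf k \ Xf (k - 1)))
    (U : ℕ → ℕ → Set X)
    (hUsub : ∀ k j, 1 ≤ k → k ≤ m → U k j ⊆ Xf k)
    (hUopen : ∀ k j, 1 ≤ k → k ≤ m →
      IsOpen (Subtype.val ⁻¹' U k j : Set ↥(Xf k)))
    (hUcontains : ∀ k j, 1 ≤ k → k ≤ m → Xf (k - 1) ⊆ U k j)
    (hUinter : ∀ k, 1 ≤ k → k ≤ m → Xf (k - 1) = ⋂ j, U k j)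
    (Z : Set X) (hZ : IsCompact Z) :
    ∃ W : ℕ → Set X, (∀ j, IsOpen (W j)) ∧ (∀ j, Z ⊆ W j) ∧ Z = ⋂ j, W j := by
  let C : Fin m × ℕ → Set X := fun p => Xf (p.1 + 1) \ U (p.1 + 1) p.2
  have hC : ∀ p, IsClosed (C p) := fun p =>
    (hclosed _ p.1.2).sdiff_of_isOpen_preimage_val (hUopen _ _ (Nat.le_add_left 1 _) p.1.2)
  have hCmetr : ∀ p, TopologicalSpace.MetrizableSpace (C p) := fun p => by
    have := hmetr (p.1 + 1) (Nat.le_add_left 1 _) p.1.2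
    exact (Topology.IsEmbedding.inclusion (Set.sdiff_subset_sdiff_right
      (hUcontains _ p.2 (Nat.le_add_left 1 _) p.1.2))).metrizableSpace
  have hcover : ⋃ p, C p = Set.univ := by
    refine Set.eq_univ_of_forall fun x => ?_
    obtain ⟨k, hkm, hk, hk'⟩ : ∃ k < m, x ∉ Xf k ∧ x ∈ Xf (k + 1) := by
      by_contra! h
      have hnot : ∀ k ≤ m, x ∉ Xf k := fun k => by
        induction k with
        | zero => simp [h0]
        | succ k ih => exact fun hkm => h k hkm (ih (by omega))
      exact hnot m le_rfl (hm ▸ Set.mem_univ x)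
    have hinter : Xf k = ⋂ j, U (k + 1) j := hUinter (k + 1) (Nat.le_add_left 1 k) hkm
    rw [hinter, Set.mem_iInter, not_forall] at hk
    obtain ⟨j, hj⟩ := hk
    exact Set.mem_iUnion.2 ⟨(⟨k, hkm⟩, j), hk', hj⟩
  obtain ⟨W, hW, hZW⟩ := isGδ_iff_eq_iInter_nat.1 (hZ.isGδ_of_iUnion_metrizable hC hCmetr hcover)
  exact ⟨W, hW, fun j => hZW.subset.trans (Set.iInter_subset W j), hZW⟩
end

section
/- If ⋎ is an equivalence relation on the disjoint union ⨆_{I∈𝓘} U_I, then the lifted relation ⋎̃ is an equivalence relation on the disjoint union ⨆_{I∈𝓘} E_I. (This is the first claim of the paper's Lemma 4.5: for a good coordinate system, the equivalence relation on the union of Kuranishi chart domains lifts, via the bundle maps of the coordinate changes, to an equivalence relation on the union of the obstruction bundles; the proof uses the cocycle condition and injectivity of the bundle maps.) -/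
/-- The relation `⋎` on the disjoint union `⨆_I U_I` of the chart domains:
`x ∈ U_I` is related to `y ∈ U_J` iff they are equal (with `I = J`), or `I ≤ J`,
`x ∈ U_{JI}` and `y = φ_{JI}(x)`, or symmetrically. -/
def chartRel {𝓘 : Type*} [PartialOrder 𝓘] {U : 𝓘 → Type*}
    (Usub : ∀ I J : 𝓘, Set (U I)) (φ : ∀ I J : 𝓘, U I → U J)
    (p q : Σ I : 𝓘, U I) : Prop :=
  p = q ∨ (p.1 ≤ q.1 ∧ p.2 ∈ Usub p.1 q.1 ∧ q.2 = φ p.1 q.1 p.2) ∨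
    (q.1 ≤ p.1 ∧ q.2 ∈ Usub q.1 p.1 ∧ p.2 = φ q.1 p.1 q.2)

/-- The lifted relation `⋎̃` on the disjoint union `⨆_I E_I` of the obstruction
bundles, defined analogously using the bundle maps `φ̂_{JI}` on `π_I^{-1}(U_{JI})`. -/
def bundleRel {𝓘 : Type*} [PartialOrder 𝓘] {U E : 𝓘 → Type*}
    (π : ∀ I : 𝓘, E I → U I)
    (Usub : ∀ I J : 𝓘, Set (U I)) (φhat : ∀ I J : 𝓘, E I → E J)
    (p q : Σ I : 𝓘, E I) : Prop :=
  p = q ∨ (p.1 ≤ q.1 ∧ π p.1 p.2 ∈ Usub p.1 q.1 ∧ q.2 = φhat p.1 q.1 p.2) ∨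
    (q.1 ≤ p.1 ∧ π q.1 q.2 ∈ Usub q.1 p.1 ∧ p.2 = φhat q.1 p.1 q.2)

/-- `q` is the image of `p` under the coordinate change between their indices. -/
def IsImage {𝓘 : Type*} [PartialOrder 𝓘] {X : 𝓘 → Type*} (D : ∀ I _ : 𝓘, Set (X I))
    (f : ∀ I J : 𝓘, X I → X J) (p q : Σ I : 𝓘, X I) : Prop :=
  p.1 ≤ q.1 ∧ p.2 ∈ D p.1 q.1 ∧ q.2 = f p.1 q.1 p.2

theorem isImage_refl {𝓘 : Type*} [PartialOrder 𝓘] {X : 𝓘 → Type*}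
    {D : ∀ I _ : 𝓘, Set (X I)} {f : ∀ I J : 𝓘, X I → X J}
    (hD : ∀ I, D I I = Set.univ) (hf : ∀ I x, f I I x = x) (p : Σ I : 𝓘, X I) :
    IsImage D f p p :=
  ⟨le_rfl, by rw [hD]; trivial, (hf _ _).symm⟩

theorem chartRel_iff_isImage {𝓘 : Type*} [PartialOrder 𝓘] {X : 𝓘 → Type*}
    {D : ∀ I _ : 𝓘, Set (X I)} {f : ∀ I J : 𝓘, X I → X J}
    (hD : ∀ I, D I I = Set.univ) (hf : ∀ I x, f I I x = x) (p q : Σ I : 𝓘, X I) :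
    chartRel D f p q ↔ IsImage D f p q ∨ IsImage D f q p := by
  refine ⟨?_, Or.inr⟩
  rintro (rfl | h)
  · exact Or.inl (isImage_refl hD hf p)
  · exact h

theorem IsImage.eq_of_le {𝓘 : Type*} [PartialOrder 𝓘] {X : 𝓘 → Type*}
    {D : ∀ I _ : 𝓘, Set (X I)} {f : ∀ I J : 𝓘, X I → X J}
    (hf : ∀ I x, f I I x = x) {p q : Σ I : 𝓘, X I} (h : IsImage D f p q) (hle : q.1 ≤ p.1) :
    p = q := by
  obtain ⟨I, x⟩ := p
  obtain ⟨J, y⟩ := q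
  obtain ⟨hIJ, -, hy⟩ := h
  obtain rfl : I = J := le_antisymm hIJ hle
  simp only [hf] at hy
  rw [hy]

/-- Lemma 4.5 (first claim): if `⋎` is an equivalence relation on `⨆_I U_I`, then the
lifted relation `⋎̃` is an equivalence relation on `⨆_I E_I`. -/
theorem bundleRel_equivalence {𝓘 : Type*} [PartialOrder 𝓘] {U E : 𝓘 → Type*}
    (π : ∀ I : 𝓘, E I → U I)
    (Usub : ∀ I J : 𝓘, Set (U I))
    (φ : ∀ I J : 𝓘, U I → U J)
    (φhat : ∀ I J : 𝓘, E I → E J)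
    (hbundle : ∀ I J : 𝓘, I ≤ J → ∀ e : E I, π I e ∈ Usub I J →
      π J (φhat I J e) = φ I J (π I e))
    (hinj : ∀ I J : 𝓘, I ≤ J → Set.InjOn (φhat I J) {e : E I | π I e ∈ Usub I J})
    (hUII : ∀ I : 𝓘, Usub I I = Set.univ)
    (hφII : ∀ I : 𝓘, ∀ x : U I, φ I I x = x)
    (hφhatII : ∀ I : 𝓘, ∀ e : E I, φhat I I e = e)
    (hcocycle : ∀ I J K : 𝓘, I ≤ J → J ≤ K → ∀ e : E I,
      π I e ∈ Usub I K → φ I J (π I e) ∈ Usub J K →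
      φhat I K e = φhat J K (φhat I J e))
    (hequiv : Equivalence (chartRel Usub φ)) :
    Equivalence (bundleRel π Usub φhat) := by
  let D : ∀ I _ : 𝓘, Set (E I) := fun I J => {e | π I e ∈ Usub I J}
  let proj : (Σ I : 𝓘, E I) → Σ I : 𝓘, U I := fun p => ⟨p.1, π p.1 p.2⟩
  have hD : ∀ I, D I I = Set.univ := fun I => by simp [D, hUII]
  have hrel : ∀ p q, bundleRel π Usub φhat p q ↔
      IsImage D φhat p q ∨ IsImage D φhat q p :=
    chartRel_iff_isImage hD hφhatII
  have hproj : ∀ {p q}, IsImage D φhat p q → IsImage Usub φ (proj p) (proj q) := by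
    rintro p q ⟨hle, hmem, hq⟩
    exact ⟨hle, hmem, (congrArg (π q.1) hq).trans (hbundle _ _ hle _ hmem)⟩
  have lift_comp : ∀ {p q r}, IsImage D φhat p q → IsImage D φhat q r →
      IsImage Usub φ (proj p) (proj r) → IsImage D φhat p r := by
    rintro p q r hpq ⟨hqr, hq, hr⟩ ⟨hpr, hp, -⟩
    refine ⟨hpr, hp, ?_⟩
    rw [hr, hpq.2.2]
    exact (hcocycle _ _ _ hpq.1 hqr _ hp ((hproj hpq).2.2 ▸ hq)).symm
  have lift_target : ∀ {p q r}, IsImage D φhat p q → IsImage D φhat p r →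
      IsImage Usub φ (proj q) (proj r) → IsImage D φhat q r := by
    rintro p q r hpq ⟨_, hp, hr⟩ ⟨hqr, hq, -⟩
    refine ⟨hqr, hq, ?_⟩
    rw [hr, hpq.2.2]
    exact hcocycle _ _ _ hpq.1 hqr _ hp ((hproj hpq).2.2 ▸ hq)
  have lift_source : ∀ {p q r}, IsImage D φhat p r → IsImage D φhat q r →
      IsImage Usub φ (proj p) (proj q) → IsImage D φhat p q := by
    rintro ⟨I, e⟩ ⟨J, f⟩ ⟨K, g⟩ ⟨_, hp, hg⟩ ⟨hqr, hq, hg'⟩ ⟨hpq, hp', hf⟩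
    dsimp only [D, proj, Set.mem_ofPred_eq] at hp hg hqr hq hg' hpq hp' hf ⊢
    have hmem : φ I J (π I e) ∈ Usub J K := hf ▸ hq
    refine ⟨hpq, hp', hinj _ _ hqr hq ?_ ?_⟩
    · simpa only [Set.mem_ofPred_eq, hbundle _ _ hpq _ hp'] using hmem
    · rw [← hg', hg]
      exact hcocycle _ _ _ hpq hqr _ hp hmem
  have trans_up : ∀ {p q r}, IsImage D φhat p q → IsImage D φhat q r →
      IsImage Usub φ (proj p) (proj r) ∨ IsImage Usub φ (proj r) (proj p) →
      IsImage D φhat p r := by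
    rintro p q r hpq hqr (h | h)
    · exact lift_comp hpq hqr h
    · rw [hpq.eq_of_le hφhatII (hqr.1.trans h.1)]
      exact hqr
  refine ⟨fun p => Or.inl rfl, fun {p q} h => (hrel q p).2 ((hrel p q).1 h).symm,
    fun {p q r} h₁ h₂ => ?_⟩
  rw [hrel] at h₁ h₂ ⊢
  have hpr : IsImage Usub φ (proj p) (proj r) ∨ IsImage Usub φ (proj r) (proj p) := by
    rw [← chartRel_iff_isImage hUII hφII]
    refine hequiv.trans (y := proj q) ?_ ?_ <;> rw [chartRel_iff_isImage hUII hφII]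
    · exact h₁.imp hproj hproj
    · exact h₂.imp hproj hproj
  rcases h₁ with h₁ | h₁ <;> rcases h₂ with h₂ | h₂
  · exact Or.inl (trans_up h₁ h₂ hpr)
  · exact hpr.imp (lift_source h₁ h₂) (lift_source h₂ h₁)
  · exact hpr.imp (lift_target h₁ h₂) (lift_target h₂ h₁)
  · exact Or.inr (trans_up h₂ h₁ hpr.symm)
end
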